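/- arXiv:math-ph/0308032 — 2 statements merged into one kernel-verified Lean document; each statement's English description precedes it below -/
import Mathlib

section
/- Let (a_k)_{k≥1} be a sequence of complex numbers with Σ_{k=1}^∞ |a_k| < ∞ and let V(x) = Σ_{k=1}^∞ a_k e^{ikx}. Then for z ∈ ℂ, the Hill equation −ψ'' + Vψ = zψ has a nontrivial bounded solution ψ : ℝ → ℂ if and only if z is a nonnegative real number. -/
noncomputable section

/-- `ψ` is a (twice differentiable) solution of the Hill equation `-ψ'' + V ψ = z ψ` on `ℝ`. -/
def IsHillSolution (V : ℝ → ℂ) (z : ℂ) (ψ : ℝ → ℂ) : Prop :=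
  Differentiable ℝ ψ ∧ Differentiable ℝ (deriv ψ) ∧
    ∀ x : ℝ, -deriv (deriv ψ) x + V x * ψ x = z * ψ x

open Complex Finset.HasAntidiagonal

/-- The one-sided Fourier series `∑_{n ≥ 0} c_n e^{inx}`. -/
def oneSidedFourier (c : ℕ → ℂ) (x : ℝ) : ℂ :=
  ∑' n : ℕ, c n * exp (I * (n : ℂ) * (x : ℂ))

theorem norm_exp_I_mul (w : ℂ) (x : ℝ) : ‖exp (I * w * x)‖ = Real.exp (-w.im * x) := by
  rw [norm_exp]
  simp

theorem norm_exp_I_mul_natCast (n : ℕ) (x : ℝ) : ‖exp (I * (n : ℂ) * (x : ℂ))‖ = 1 := by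
  simp [norm_exp_I_mul]

theorem summable_norm_oneSidedFourier {c : ℕ → ℂ} (hc : Summable fun n => ‖c n‖) (x : ℝ) :
    Summable fun n : ℕ => ‖c n * exp (I * (n : ℂ) * (x : ℂ))‖ := by
  simpa [norm_exp_I_mul_natCast] using hc

theorem norm_oneSidedFourier_le {c : ℕ → ℂ} (hc : Summable fun n => ‖c n‖) (x : ℝ) :
    ‖oneSidedFourier c x‖ ≤ ∑' n, ‖c n‖ := by
  refine (norm_tsum_le_tsum_norm (summable_norm_oneSidedFourier hc x)).trans_eq ?_
  simp [norm_exp_I_mul_natCast]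

theorem oneSidedFourier_add_int_mul_two_pi (c : ℕ → ℂ) (x : ℝ) (m : ℤ) :
    oneSidedFourier c (x + m * (2 * Real.pi)) = oneSidedFourier c x := by
  unfold oneSidedFourier
  congr 1
  ext n
  congr 1
  rw [exp_eq_exp_iff_exists_int]
  exact ⟨n * m, by push_cast; ring⟩

theorem oneSidedFourier_mul {c d : ℕ → ℂ} (hc : Summable fun n => ‖c n‖)
    (hd : Summable fun n => ‖d n‖) (x : ℝ) :
    oneSidedFourier c x * oneSidedFourier d x =
      oneSidedFourier (fun n => ∑ kl ∈ antidiagonal n, c kl.1 * d kl.2) x := by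
  unfold oneSidedFourier
  rw [tsum_mul_tsum_eq_tsum_sum_antidiagonal_of_summable_norm
    (summable_norm_oneSidedFourier hc x) (summable_norm_oneSidedFourier hd x)]
  congr 1
  ext n
  rw [Finset.sum_mul]
  refine Finset.sum_congr rfl fun kl hkl => ?_
  rw [← mem_antidiagonal.1 hkl, mul_mul_mul_comm, ← exp_add]
  push_cast
  ring_nf

theorem hasDerivAt_oneSidedFourier {c : ℕ → ℂ} (hc : Summable fun n : ℕ => ‖I * n * c n‖)
    (hc0 : Summable fun n => ‖c n‖) (x : ℝ) :
    HasDerivAt (oneSidedFourier c) (oneSidedFourier (fun n => I * n * c n) x) x := by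
  unfold oneSidedFourier
  refine hasDerivAt_tsum (g := fun (n : ℕ) (y : ℝ) => c n * exp (I * (n : ℂ) * (y : ℂ)))
    (g' := fun (n : ℕ) (y : ℝ) => I * n * c n * exp (I * (n : ℂ) * (y : ℂ))) (y₀ := 0)
    (u := fun n : ℕ => ‖I * n * c n‖) hc (fun n y => ?_) (fun n y => ?_)
    (summable_norm_oneSidedFourier hc0 0).of_norm x
  · have h : HasDerivAt (fun y : ℝ => I * (n : ℂ) * (y : ℂ)) (I * n) y := by
      simpa using (hasDerivAt_id y).ofReal_comp.const_mul (I * (n : ℂ))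
    exact (h.cexp.const_mul (c n)).congr_deriv (by ring)
  · rw [norm_mul, norm_exp_I_mul_natCast, mul_one]

theorem integral_exp_I_mul_natCast (n : ℕ) (hn : n ≠ 0) :
    ∫ x in (0 : ℝ)..2 * Real.pi, exp (I * (n : ℂ) * (x : ℂ)) = 0 := by
  have h : I * (n : ℂ) ≠ 0 := by simp [hn]
  rw [integral_exp_mul_complex h]
  have : exp (I * n * ((2 * Real.pi : ℝ) : ℂ)) = 1 := by
    rw [exp_eq_one_iff]
    exact ⟨n, by push_cast; ring⟩
  rw [this]
  simp

theorem integral_oneSidedFourier {c : ℕ → ℂ} (hc : Summable fun n => ‖c n‖) :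
    ∫ x in (0 : ℝ)..2 * Real.pi, oneSidedFourier c x = 2 * Real.pi * c 0 := by
  have h := intervalIntegral.hasSum_intervalIntegral_of_summable_norm (a := 0) (b := 2 * Real.pi)
    (f := fun n : ℕ => (⟨fun x : ℝ => c n * exp (I * (n : ℂ) * (x : ℂ)), by fun_prop⟩ : C(ℝ, ℂ)))
    (hc.of_nonneg_of_le (fun _ => norm_nonneg _) fun n => by
      rw [ContinuousMap.norm_le _ (norm_nonneg _)]
      intro x
      simp [norm_exp_I_mul_natCast])
  have h' := h.tsum_eq
  simp only [ContinuousMap.coe_mk] at h'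
  unfold oneSidedFourier
  rw [← h', tsum_eq_single 0]
  · simp
  · intro n hn
    rw [intervalIntegral.integral_const_mul, integral_exp_I_mul_natCast n hn, mul_zero]

/-- If a one-sided Fourier series is constant, its value is its zeroth coefficient. -/
theorem eq_coeff_zero_of_oneSidedFourier_const {c : ℕ → ℂ} (hc : Summable fun n => ‖c n‖) {w : ℂ}
    (h : ∀ x, oneSidedFourier c x = w) : w = c 0 := by
  have h1 := integral_oneSidedFourier hc
  simp only [h, intervalIntegral.integral_const, sub_zero, real_smul] at h1
  have h2 : (2 * Real.pi : ℂ) ≠ 0 := by simp [Real.pi_ne_zero]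
  push_cast at h1
  exact mul_left_cancel₀ h2 h1

theorem exists_oneSidedFourier_ne_zero {c : ℕ → ℂ} (hc : Summable fun n => ‖c n‖) (h0 : c 0 ≠ 0) :
    ∃ x, oneSidedFourier c x ≠ 0 := by
  by_contra! h
  exact h0 (eq_coeff_zero_of_oneSidedFourier_const hc h).symm

/-- A multiple of `e^{iκx} ∑ c_n e^{inx}` that stays bounded in the direction in which `e^{iκx}`
grows must vanish. -/
theorem eq_zero_of_exp_mul_oneSidedFourier_bounded {c : ℕ → ℂ} (hc : Summable fun n => ‖c n‖)
    (h0 : c 0 ≠ 0) {κ : ℂ} {m : ℤ} (hm : m * κ.im < 0) {A : ℂ} {C : ℝ}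
    (h : ∀ x : ℝ, 0 ≤ m * x → ‖A * (exp (I * κ * x) * oneSidedFourier c x)‖ ≤ C) : A = 0 := by
  obtain ⟨x₀, hx₀⟩ := exists_oneSidedFourier_ne_zero hc h0
  by_contra hA
  have hpos : 0 < ‖A‖ * ‖oneSidedFourier c x₀‖ := by positivity
  have hm0 : (m : ℝ) ≠ 0 := by rintro h; simp [h] at hm
  have lin : ∀ r s : ℝ, 0 < s →
      Filter.Tendsto (fun n : ℕ => r + s * (n : ℝ)) Filter.atTop Filter.atTop := fun r s hs =>
    Filter.tendsto_atTop_add_const_left _ _ (tendsto_natCast_atTop_atTop.const_mul_atTop hs)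
  have e1 : ∀ᶠ n : ℕ in Filter.atTop, 0 ≤ m * (x₀ + (m * n : ℤ) * (2 * Real.pi)) := by
    have hs : 0 < (m : ℝ) ^ 2 * (2 * Real.pi) := by positivity
    filter_upwards [(lin (m * x₀) _ hs).eventually_ge_atTop 0] with n hn
    push_cast
    linarith
  have e2 : ∀ᶠ n : ℕ in Filter.atTop, C / (‖A‖ * ‖oneSidedFourier c x₀‖) <
      Real.exp (-κ.im * (x₀ + (m * n : ℤ) * (2 * Real.pi))) := by
    have hs : 0 < -(m * κ.im) * (2 * Real.pi) := mul_pos (by linarith) (by positivity)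
    filter_upwards [(Real.tendsto_exp_atTop.comp
      (lin (-κ.im * x₀) _ hs)).eventually_gt_atTop _] with n hn
    refine hn.trans_eq ?_
    simp only [Function.comp]
    push_cast
    ring_nf
  obtain ⟨n, hn1, hn2⟩ := (e1.and e2).exists
  have h3 := h _ hn1
  rw [oneSidedFourier_add_int_mul_two_pi, norm_mul, norm_mul, norm_exp_I_mul] at h3
  rw [div_lt_iff₀ hpos] at hn2
  linarith

/-- The coefficients of the periodic factor of the Floquet solution with exponent `lam`. -/
def floquetCoeff (a : ℕ → ℂ) (lam : ℂ) : ℕ → ℂ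
  | 0 => 1
  | n + 1 => -(∑ k : Fin (n + 1), floquetCoeff a lam k * a (n - k)) /
      ((n + 1) * (n + 1 + 2 * lam))

theorem floquetCoeff_zero (a : ℕ → ℂ) (lam : ℂ) : floquetCoeff a lam 0 = 1 := by
  rw [floquetCoeff]

theorem floquetCoeff_succ (a : ℕ → ℂ) (lam : ℂ) (n : ℕ) :
    floquetCoeff a lam (n + 1) =
      -(∑ kl ∈ antidiagonal n, floquetCoeff a lam kl.1 * a kl.2) /
        ((n + 1) * (n + 1 + 2 * lam)) := by
  rw [floquetCoeff, Fin.sum_univ_eq_sum_range (fun k => floquetCoeff a lam k * a (n - k)),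
    Finset.Nat.sum_antidiagonal_eq_sum_range_succ (fun k l => floquetCoeff a lam k * a l)]

theorem sq_mul_norm_floquetCoeff_succ_le (a : ℕ → ℂ) {lam : ℂ} {δ : ℝ} (hδ : 0 < δ)
    (hlam : ∀ n : ℕ, δ * (n + 1) ≤ ‖(n + 1 + 2 * lam : ℂ)‖) (n : ℕ) :
    (n + 1 : ℝ) ^ 2 * ‖floquetCoeff a lam (n + 1)‖ ≤
      δ⁻¹ * ‖∑ kl ∈ antidiagonal n, floquetCoeff a lam kl.1 * a kl.2‖ := by
  have h1 : (0 : ℝ) < n + 1 := by positivity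
  have h2 : 0 < ‖(n + 1 + 2 * lam : ℂ)‖ := (mul_pos hδ h1).trans_le (hlam n)
  have h3 : ‖(n + 1 : ℂ)‖ = n + 1 := by
    rw [← Nat.cast_add_one, Complex.norm_natCast]; push_cast; rfl
  rw [floquetCoeff_succ, norm_div, norm_neg, norm_mul, h3, ← mul_div_assoc,
    div_le_iff₀ (by positivity)]
  set S := ‖∑ kl ∈ antidiagonal n, floquetCoeff a lam kl.1 * a kl.2‖
  have hS : 0 ≤ S := norm_nonneg _
  calc (n + 1 : ℝ) ^ 2 * S = δ⁻¹ * S * ((n + 1) * (δ * (n + 1))) := by field_simp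
    _ ≤ _ := by gcongr; exact hlam n

theorem norm_sum_antidiagonal_mul_le {a c : ℕ → ℂ} (ha : Summable fun k => ‖a k‖) {M : ℝ}
    (hM : 0 ≤ M) {n : ℕ} (hc : ∀ k ≤ n, ‖c k‖ ≤ M) :
    ‖∑ kl ∈ antidiagonal n, c kl.1 * a kl.2‖ ≤ M * ∑' k, ‖a k‖ := by
  rw [Finset.Nat.sum_antidiagonal_eq_sum_range_succ (fun k l => c k * a l)]
  calc _ ≤ ∑ k ∈ Finset.range (n + 1), M * ‖a (n - k)‖ := by
        refine norm_sum_le_of_le _ fun k hk => ?_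
        rw [norm_mul]
        gcongr
        exact hc k (Nat.lt_succ_iff.1 (Finset.mem_range.1 hk))
    _ = M * ∑ k ∈ Finset.range (n + 1), ‖a k‖ := by
        rw [← Finset.mul_sum, ← Finset.sum_range_reflect (fun k => ‖a k‖)]
        simp
    _ ≤ _ := by
        gcongr
        exact ha.sum_le_tsum _ fun _ _ => norm_nonneg _

theorem floquetCoeff_bounded {a : ℕ → ℂ} (ha : Summable fun k => ‖a k‖) {lam : ℂ} {δ : ℝ}
    (hδ : 0 < δ) (hlam : ∀ n : ℕ, δ * (n + 1) ≤ ‖(n + 1 + 2 * lam : ℂ)‖) :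
    ∃ M : ℝ, 0 ≤ M ∧ ∀ n, ‖floquetCoeff a lam n‖ ≤ M := by
  obtain ⟨K, hK⟩ := exists_nat_ge (δ⁻¹ * ∑' k, ‖a k‖)
  refine ⟨∑ k ∈ Finset.range (K + 1), ‖floquetCoeff a lam k‖, by positivity, fun n => ?_⟩
  set M := ∑ k ∈ Finset.range (K + 1), ‖floquetCoeff a lam k‖ with hM
  have hM0 : 0 ≤ M := by positivity
  induction n using Nat.strong_induction_on with
  | _ n ih =>
    rcases le_or_gt n K with hn | hn
    · exact Finset.single_le_sum (f := fun k => ‖floquetCoeff a lam k‖)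
        (fun _ _ => norm_nonneg _) (Finset.mem_range.2 (by omega))
    · obtain ⟨m, rfl⟩ : ∃ m, n = m + 1 := ⟨n - 1, by omega⟩
      have h1 := sq_mul_norm_floquetCoeff_succ_le a hδ hlam m
      have h2 : ‖∑ kl ∈ antidiagonal m, floquetCoeff a lam kl.1 * a kl.2‖ ≤
          M * ∑' k, ‖a k‖ :=
        norm_sum_antidiagonal_mul_le ha hM0 fun k hk => ih k (Nat.lt_succ_of_le hk)
      have h3 : (K : ℝ) ≤ m := by exact_mod_cast Nat.lt_succ_iff.1 hn
      have h4 : (m + 1 : ℝ) ^ 2 * ‖floquetCoeff a lam (m + 1)‖ ≤ (m + 1 : ℝ) ^ 2 * M :=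
        calc _ ≤ δ⁻¹ * (M * ∑' k, ‖a k‖) := h1.trans (by gcongr)
          _ = δ⁻¹ * (∑' k, ‖a k‖) * M := by ring
          _ ≤ _ := by
              gcongr
              nlinarith [(Nat.cast_nonneg m : (0 : ℝ) ≤ m)]
      exact le_of_mul_le_mul_left h4 (by positivity)

theorem summable_sq_mul_norm_floquetCoeff {a : ℕ → ℂ} (ha : Summable fun k => ‖a k‖) {lam : ℂ}
    {δ : ℝ} (hδ : 0 < δ) (hlam : ∀ n : ℕ, δ * (n + 1) ≤ ‖(n + 1 + 2 * lam : ℂ)‖) :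
    Summable fun n : ℕ => (n : ℝ) ^ 2 * ‖floquetCoeff a lam n‖ := by
  obtain ⟨M, hM, hb⟩ := floquetCoeff_bounded ha hδ hlam
  have hsum : Summable fun n => ‖floquetCoeff a lam n‖ := by
    rw [← summable_nat_add_iff 1]
    have hs : Summable fun n : ℕ => δ⁻¹ * (M * ∑' k, ‖a k‖) * (1 / ((n + 1 : ℕ) : ℝ) ^ 2) :=
      ((summable_nat_add_iff 1).2 (Real.summable_one_div_nat_pow.2 one_lt_two)).mul_left _
    refine hs.of_nonneg_of_le (fun _ => norm_nonneg _) fun n => ?_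
    rw [mul_one_div, le_div_iff₀ (by positivity), mul_comm]
    push_cast
    refine (sq_mul_norm_floquetCoeff_succ_le a hδ hlam n).trans ?_
    gcongr
    exact norm_sum_antidiagonal_mul_le ha hM fun k _ => hb k
  rw [← summable_nat_add_iff 1]
  refine ((summable_norm_sum_mul_antidiagonal_of_summable_norm hsum ha).mul_left
    δ⁻¹).of_nonneg_of_le (fun _ => by positivity) fun n => ?_
  push_cast
  exact sq_mul_norm_floquetCoeff_succ_le a hδ hlam n

theorem summable_norm_of_summable_sq_mul {c : ℕ → ℂ}
    (hc : Summable fun n : ℕ => (n : ℝ) ^ 2 * ‖c n‖) : Summable fun n => ‖c n‖ := by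
  rw [← summable_nat_add_iff 1] at hc ⊢
  refine hc.of_nonneg_of_le (fun _ => norm_nonneg _) fun n => ?_
  refine le_mul_of_one_le_left (norm_nonneg _) (one_le_pow₀ ?_)
  exact_mod_cast Nat.le_add_left 1 n

theorem summable_natCast_mul_norm_of_summable_sq_mul {c : ℕ → ℂ}
    (hc : Summable fun n : ℕ => (n : ℝ) ^ 2 * ‖c n‖) : Summable fun n : ℕ => (n : ℝ) * ‖c n‖ := by
  refine hc.of_nonneg_of_le (fun _ => by positivity) fun n => ?_
  gcongr
  exact_mod_cast Nat.le_self_pow two_ne_zero n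

theorem summable_norm_I_mul_add_mul {c : ℕ → ℂ} (hc0 : Summable fun n => ‖c n‖)
    (hc : Summable fun n : ℕ => (n : ℝ) * ‖c n‖) (lam : ℂ) :
    Summable fun n : ℕ => ‖I * (lam + n) * c n‖ := by
  refine ((hc0.mul_left ‖lam‖).add hc).of_nonneg_of_le (fun _ => norm_nonneg _) fun n => ?_
  rw [norm_mul, norm_mul, norm_I, one_mul, ← add_mul]
  gcongr
  exact (norm_add_le _ _).trans_eq (by rw [Complex.norm_natCast])

theorem hasDerivAt_exp_mul_oneSidedFourier {c : ℕ → ℂ} (hc0 : Summable fun n => ‖c n‖)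
    (hc : Summable fun n : ℕ => (n : ℝ) * ‖c n‖) (lam : ℂ) (x : ℝ) :
    HasDerivAt (fun x : ℝ => exp (I * lam * x) * oneSidedFourier c x)
      (exp (I * lam * x) * oneSidedFourier (fun n => I * (lam + n) * c n) x) x := by
  have h : HasDerivAt (fun y : ℝ => I * lam * (y : ℂ)) (I * lam) x := by
    simpa using (hasDerivAt_id x).ofReal_comp.const_mul (I * lam)
  have hc1 : Summable fun n : ℕ => ‖I * n * c n‖ := by simpa using hc
  refine (h.cexp.mul (hasDerivAt_oneSidedFourier hc1 hc0 x)).congr_deriv ?_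
  have : oneSidedFourier (fun n => I * (lam + n) * c n) x =
      I * lam * oneSidedFourier c x + oneSidedFourier (fun n => I * n * c n) x := by
    unfold oneSidedFourier
    rw [← tsum_mul_left, ← ((summable_norm_oneSidedFourier hc0 x).of_norm.mul_left _).tsum_add
      (summable_norm_oneSidedFourier hc1 x).of_norm]
    congr 1
    ext n
    ring
  rw [this]
  ring

/-- The Floquet solution `e^{i lam x} ∑ c_n e^{inx}`, of energy `lam ^ 2`. -/
def floquetSolution (a : ℕ → ℂ) (lam : ℂ) (x : ℝ) : ℂ :=
  exp (I * lam * x) * oneSidedFourier (floquetCoeff a lam) x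

section FloquetSolution

variable {a : ℕ → ℂ} {lam : ℂ} {δ : ℝ}

theorem summable_norm_floquetCoeff (ha : Summable fun k => ‖a k‖) (hδ : 0 < δ)
    (hlam : ∀ n : ℕ, δ * (n + 1) ≤ ‖(n + 1 + 2 * lam : ℂ)‖) :
    Summable fun n => ‖floquetCoeff a lam n‖ :=
  summable_norm_of_summable_sq_mul (summable_sq_mul_norm_floquetCoeff ha hδ hlam)

theorem hasDerivAt_floquetSolution (ha : Summable fun k => ‖a k‖) (hδ : 0 < δ)
    (hlam : ∀ n : ℕ, δ * (n + 1) ≤ ‖(n + 1 + 2 * lam : ℂ)‖) (x : ℝ) :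
    HasDerivAt (floquetSolution a lam) (exp (I * lam * x) *
      oneSidedFourier (fun n => I * (lam + n) * floquetCoeff a lam n) x) x :=
  hasDerivAt_exp_mul_oneSidedFourier (summable_norm_floquetCoeff ha hδ hlam)
    (summable_natCast_mul_norm_of_summable_sq_mul
      (summable_sq_mul_norm_floquetCoeff ha hδ hlam)) lam x

theorem isHillSolution_floquetSolution (ha : Summable fun k => ‖a k‖) (hδ : 0 < δ)
    (hlam : ∀ n : ℕ, δ * (n + 1) ≤ ‖(n + 1 + 2 * lam : ℂ)‖) {V : ℝ → ℂ}
    (hV : ∀ x : ℝ, V x = ∑' k : ℕ, a k * exp (I * ((k : ℂ) + 1) * (x : ℂ))) :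
    IsHillSolution V (lam ^ 2) (floquetSolution a lam) := by
  set c := floquetCoeff a lam with hc
  have hs2 := summable_sq_mul_norm_floquetCoeff ha hδ hlam
  have hs1 := summable_natCast_mul_norm_of_summable_sq_mul hs2
  have hs0 := summable_norm_floquetCoeff ha hδ hlam
  have hd : deriv (floquetSolution a lam) = fun x : ℝ => exp (I * lam * x) *
      oneSidedFourier (fun n => I * (lam + n) * c n) x :=
    funext fun x => (hasDerivAt_floquetSolution ha hδ hlam x).deriv
  have hs0' := summable_norm_I_mul_add_mul hs0 hs1 lam
  have hs1' : Summable fun n : ℕ => (n : ℝ) * ‖I * (lam + n) * c n‖ := by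
    refine ((hs1.mul_left ‖lam‖).add hs2).of_nonneg_of_le (fun _ => by positivity) fun n => ?_
    rw [norm_mul, norm_mul, norm_I, one_mul]
    calc (n : ℝ) * (‖lam + n‖ * ‖c n‖) ≤ n * ((‖lam‖ + n) * ‖c n‖) := by
          gcongr
          exact (norm_add_le _ _).trans_eq (by rw [Complex.norm_natCast])
      _ = _ := by ring
  have hd2 := fun x => hasDerivAt_exp_mul_oneSidedFourier hs0' hs1' lam x
  refine ⟨fun x => (hasDerivAt_floquetSolution ha hδ hlam x).differentiableAt, ?_, fun x => ?_⟩
  · rw [hd]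
    exact fun x => (hd2 x).differentiableAt
  rw [hd, (hd2 x).deriv]
  have hVx : V x = exp (I * x) * oneSidedFourier a x := by
    rw [hV, oneSidedFourier, ← tsum_mul_left]
    congr 1
    ext k
    rw [mul_left_comm, ← exp_add]
    ring_nf
  have hs2' : Summable fun n : ℕ => ‖I * (lam + n) * (I * (lam + n) * c n)‖ :=
    summable_norm_I_mul_add_mul hs0' hs1' lam
  have key : V x * oneSidedFourier c x =
      lam ^ 2 * oneSidedFourier c x +
        oneSidedFourier (fun n => I * (lam + n) * (I * (lam + n) * c n)) x := by
    rw [hVx, mul_assoc, mul_comm (oneSidedFourier a x), oneSidedFourier_mul hs0 ha]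
    unfold oneSidedFourier
    have hS := ((summable_norm_oneSidedFourier hs0 x).of_norm.mul_left (lam ^ 2)).add
      (summable_norm_oneSidedFourier hs2' x).of_norm
    rw [← tsum_mul_left, ← tsum_mul_left,
      ← ((summable_norm_oneSidedFourier hs0 x).of_norm.mul_left (lam ^ 2)).tsum_add
      (summable_norm_oneSidedFourier hs2' x).of_norm, hS.tsum_eq_zero_add]
    have hz : lam ^ 2 * (c 0 * exp (I * ((0 : ℕ) : ℂ) * x)) +
        I * (lam + ((0 : ℕ) : ℂ)) * (I * (lam + ((0 : ℕ) : ℂ)) * c 0) *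
          exp (I * ((0 : ℕ) : ℂ) * x) = 0 := by
      push_cast
      linear_combination lam ^ 2 * c 0 * exp (I * 0 * x) * I_sq
    rw [hz, zero_add]
    congr 1
    ext n
    have h1 : (n + 1 : ℂ) ≠ 0 := by exact_mod_cast n.succ_ne_zero
    have h2 : (n + 1 + 2 * lam : ℂ) ≠ 0 :=
      norm_pos_iff.1 ((mul_pos hδ (by positivity)).trans_le (hlam n))
    have hrec : ∑ kl ∈ antidiagonal n, c kl.1 * a kl.2 =
        -((n + 1) * (n + 1 + 2 * lam)) * c (n + 1) := by
      rw [hc, floquetCoeff_succ]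
      field_simp
    have hexp : exp (I * ((n + 1 : ℕ) : ℂ) * x) = exp (I * x) * exp (I * n * x) := by
      rw [← exp_add]
      push_cast
      ring_nf
    change exp (I * x) * ((∑ kl ∈ antidiagonal n, c kl.1 * a kl.2) * exp (I * n * x)) =
      lam ^ 2 * (c (n + 1) * exp (I * ((n + 1 : ℕ) : ℂ) * x)) +
        I * (lam + ((n + 1 : ℕ) : ℂ)) * (I * (lam + ((n + 1 : ℕ) : ℂ)) * c (n + 1)) *
          exp (I * ((n + 1 : ℕ) : ℂ) * x)
    rw [hrec, hexp]
    push_cast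
    linear_combination -((lam + (n + 1)) ^ 2 * c (n + 1) * (exp (I * x) * exp (I * n * x))) * I_sq
  unfold floquetSolution
  linear_combination exp (I * lam * x) * key

theorem norm_floquetSolution_le (ha : Summable fun k => ‖a k‖) (hδ : 0 < δ)
    (hlam : ∀ n : ℕ, δ * (n + 1) ≤ ‖(n + 1 + 2 * lam : ℂ)‖) {x : ℝ} (hx : 0 ≤ lam.im * x) :
    ‖floquetSolution a lam x‖ ≤ ∑' n, ‖floquetCoeff a lam n‖ := by
  rw [floquetSolution, norm_mul, norm_exp_I_mul]
  refine (mul_le_of_le_one_left (norm_nonneg _) ?_).trans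
    (norm_oneSidedFourier_le (summable_norm_floquetCoeff ha hδ hlam) x)
  rw [Real.exp_le_one_iff]
  linarith

end FloquetSolution

theorem IsHillSolution.wronskian_const {V : ℝ → ℂ} {z : ℂ} {φ ψ : ℝ → ℂ}
    (hφ : IsHillSolution V z φ) (hψ : IsHillSolution V z ψ) :
    ∃ w, ∀ x, φ x * deriv ψ x - deriv φ x * ψ x = w := by
  obtain ⟨hφ1, hφ2, hφ3⟩ := hφ
  obtain ⟨hψ1, hψ2, hψ3⟩ := hψ
  have hd : ∀ x, HasDerivAt (fun x => φ x * deriv ψ x - deriv φ x * ψ x) 0 x := fun x => by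
    refine (((hφ1 x).hasDerivAt.mul (hψ2 x).hasDerivAt).sub
      ((hφ2 x).hasDerivAt.mul (hψ1 x).hasDerivAt)).congr_deriv ?_
    linear_combination -φ x * hψ3 x + ψ x * hφ3 x
  exact ⟨_, fun x => is_const_of_deriv_eq_zero (fun y => (hd y).differentiableAt)
    (fun y => (hd y).deriv) x 0⟩

theorem wronskian_floquetSolution {a : ℕ → ℂ} (ha : Summable fun k => ‖a k‖) {lam : ℂ} {δ : ℝ}
    (hδ : 0 < δ) (hlam : ∀ n : ℕ, δ * (n + 1) ≤ ‖(n + 1 + 2 * lam : ℂ)‖)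
    (hlam' : ∀ n : ℕ, δ * (n + 1) ≤ ‖(n + 1 + 2 * -lam : ℂ)‖) {V : ℝ → ℂ}
    (hV : ∀ x : ℝ, V x = ∑' k : ℕ, a k * exp (I * ((k : ℂ) + 1) * (x : ℂ))) (x : ℝ) :
    floquetSolution a lam x * deriv (floquetSolution a (-lam)) x -
      deriv (floquetSolution a lam) x * floquetSolution a (-lam) x = -2 * I * lam := by
  have hψ := isHillSolution_floquetSolution ha hδ hlam' hV
  rw [neg_sq] at hψ
  obtain ⟨w, hw⟩ := (isHillSolution_floquetSolution ha hδ hlam hV).wronskian_const hψ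
  have hc := summable_norm_floquetCoeff ha hδ hlam
  have hd := summable_norm_floquetCoeff ha hδ hlam'
  have hc' := summable_norm_I_mul_add_mul hc (summable_natCast_mul_norm_of_summable_sq_mul
    (summable_sq_mul_norm_floquetCoeff ha hδ hlam)) lam
  have hd' := summable_norm_I_mul_add_mul hd (summable_natCast_mul_norm_of_summable_sq_mul
    (summable_sq_mul_norm_floquetCoeff ha hδ hlam')) (-lam)
  have hcd := summable_norm_sum_mul_antidiagonal_of_summable_norm hc hd'
  have hdc := summable_norm_sum_mul_antidiagonal_of_summable_norm hc' hd
  have hsub := (hcd.of_norm.sub hdc.of_norm).norm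
  have hF := fun y => hw y
  simp only [(hasDerivAt_floquetSolution ha hδ hlam _).deriv,
    (hasDerivAt_floquetSolution ha hδ hlam' _).deriv] at hF
  rw [hw x, eq_coeff_zero_of_oneSidedFourier_const (w := w) hsub fun y => ?_]
  · simp [floquetCoeff_zero]
    ring
  · have hsplit : ∀ c d : ℕ → ℂ, (Summable fun n => ‖c n‖) → (Summable fun n => ‖d n‖) →
        oneSidedFourier (fun n => c n - d n) y = oneSidedFourier c y - oneSidedFourier d y := by
      intro c d hc hd
      unfold oneSidedFourier
      rw [← (summable_norm_oneSidedFourier hc y).of_norm.tsum_sub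
        (summable_norm_oneSidedFourier hd y).of_norm]
      simp only [sub_mul]
    rw [hsplit _ _ hcd hdc, ← oneSidedFourier_mul hc hd', ← oneSidedFourier_mul hc' hd, ← hF y]
    have he : exp (I * lam * y) * exp (I * -lam * y) = 1 := by
      rw [← exp_add, ← exp_zero]
      ring_nf
    unfold floquetSolution
    linear_combination (oneSidedFourier (fun n => I * (lam + n) * floquetCoeff a lam n) y *
      oneSidedFourier (floquetCoeff a (-lam)) y - oneSidedFourier (floquetCoeff a lam) y *
      oneSidedFourier (fun n => I * (-lam + n) * floquetCoeff a (-lam) n) y) * he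

theorem mul_add_one_le_norm_add_of_im_ne_zero {lam : ℂ} (h : lam.im ≠ 0) (n : ℕ) :
    |lam.im| / ‖lam‖ * (n + 1) ≤ ‖(n + 1 + 2 * lam : ℂ)‖ := by
  have h0 : 0 < ‖lam‖ := norm_pos_iff.2 fun h' => h (by simp [h'])
  rw [div_mul_eq_mul_div, div_le_iff₀ h0, ← norm_conj lam, ← norm_mul]
  refine le_trans (le_of_eq ?_) (abs_im_le_norm _)
  have : ((n + 1 + 2 * lam) * (starRingEnd ℂ) lam).im = -(lam.im * (n + 1)) := by
    simp
    ring
  rw [this, abs_neg, abs_mul, abs_of_pos (by positivity : (0 : ℝ) < n + 1)]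

/-- A bounded solution whose energy has a square root off the real axis vanishes. -/
theorem IsHillSolution.eq_zero_of_bounded {a : ℕ → ℂ} (ha : Summable fun k => ‖a k‖) {V : ℝ → ℂ}
    (hV : ∀ x : ℝ, V x = ∑' k : ℕ, a k * exp (I * ((k : ℂ) + 1) * (x : ℂ))) {lam : ℂ}
    (hlam : 0 < lam.im) {ψ : ℝ → ℂ} (hψ : IsHillSolution V (lam ^ 2) ψ) {M : ℝ}
    (hM : ∀ x, ‖ψ x‖ ≤ M) : ψ = 0 := by
  have hne : lam ≠ 0 := by rintro rfl; simp at hlam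
  have hδ : 0 < |lam.im| / ‖lam‖ := by positivity
  have h1 := mul_add_one_le_norm_add_of_im_ne_zero hlam.ne'
  have h2 : ∀ n : ℕ, |lam.im| / ‖lam‖ * (n + 1) ≤ ‖(n + 1 + 2 * -lam : ℂ)‖ := by
    simpa using mul_add_one_le_norm_add_of_im_ne_zero (lam := -lam) (by simpa using hlam.ne')
  have hp := isHillSolution_floquetSolution ha hδ h1 hV
  have hm := isHillSolution_floquetSolution ha hδ h2 hV
  rw [neg_sq] at hm
  have hw := wronskian_floquetSolution ha hδ h1 h2 hV
  obtain ⟨α, hα⟩ := hψ.wronskian_const hm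
  obtain ⟨β, hβ⟩ := hψ.wronskian_const hp
  have key : ∀ x, α * floquetSolution a lam x - β * floquetSolution a (-lam) x =
      -2 * I * lam * ψ x := fun x => by
    rw [← hw x, ← hα x, ← hβ x]
    ring
  have hK : ∀ x, ‖-2 * I * lam * ψ x‖ ≤ ‖-2 * I * lam‖ * M := fun x => by
    rw [norm_mul]
    gcongr
    exact hM x
  have hα0 : α = 0 := by
    refine eq_zero_of_exp_mul_oneSidedFourier_bounded (summable_norm_floquetCoeff ha hδ h1)
      (by simp [floquetCoeff_zero]) (κ := lam) (m := -1)
      (C := ‖-2 * I * lam‖ * M + ‖β‖ * ∑' n, ‖floquetCoeff a (-lam) n‖) (by simpa) fun x hx => ?_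
    have := norm_floquetSolution_le ha hδ h2 (x := x)
      (by rw [neg_im]; push_cast at hx; nlinarith)
    change ‖α * floquetSolution a lam x‖ ≤ _
    rw [eq_add_of_sub_eq (key x)]
    refine norm_add_le_of_le (hK x) ?_
    rw [norm_mul]
    gcongr
  have hβ0 : β = 0 := by
    refine eq_zero_of_exp_mul_oneSidedFourier_bounded (summable_norm_floquetCoeff ha hδ h2)
      (by simp [floquetCoeff_zero]) (κ := -lam) (m := 1)
      (C := ‖-2 * I * lam‖ * M) (by simpa) fun x _ => ?_
    change ‖β * floquetSolution a (-lam) x‖ ≤ _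
    have := key x
    rw [hα0, zero_mul, zero_sub] at this
    rw [← norm_neg, this]
    exact hK x
  ext x
  have := key x
  rw [hα0, hβ0, zero_mul, zero_mul, sub_zero] at this
  simpa [hne] using this.symm

/-- For `V(x) = ∑_{k=1}^∞ a_k e^{ikx}` with `∑ |a_k| < ∞`, the Hill equation
`-ψ'' + V ψ = z ψ` has a nontrivial bounded solution iff `z ∈ [0, ∞)`. -/
theorem exists_nontrivial_bounded_solution_iff
    (a : ℕ → ℂ) (ha : Summable fun k => ‖a k‖)
    (V : ℝ → ℂ)
    (hV : ∀ x : ℝ, V x = ∑' k : ℕ, a k * Complex.exp (Complex.I * ((k : ℂ) + 1) * (x : ℂ)))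
    (z : ℂ) :
    (∃ ψ : ℝ → ℂ, IsHillSolution V z ψ ∧ ψ ≠ 0 ∧ ∃ M : ℝ, ∀ x : ℝ, ‖ψ x‖ ≤ M) ↔
      ∃ t : ℝ, 0 ≤ t ∧ z = (t : ℂ) := by
  constructor
  · rintro ⟨ψ, hψ, hne, M, hM⟩
    obtain ⟨lam, rfl⟩ : ∃ lam : ℂ, lam ^ 2 = z := IsAlgClosed.exists_pow_nat_eq z two_pos
    rcases lt_trichotomy lam.im 0 with h | h | h
    · refine absurd (IsHillSolution.eq_zero_of_bounded ha hV (lam := -lam) (by simpa) ?_ hM) hne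
      rwa [neg_sq]
    · refine ⟨lam.re ^ 2, sq_nonneg _, ?_⟩
      rw [ofReal_pow]
      congr 1
      exact Complex.ext rfl h
    · exact absurd (hψ.eq_zero_of_bounded ha hV h hM) hne
  · rintro ⟨t, ht, rfl⟩
    have hlam : ∀ n : ℕ, 1 * ((n : ℝ) + 1) ≤ ‖(n + 1 + 2 * (√t : ℂ) : ℂ)‖ := fun n => by
      refine le_trans ?_ (re_le_norm _)
      simp
    refine ⟨floquetSolution a √t, ?_, fun h => ?_, _,
      fun x => norm_floquetSolution_le ha one_pos hlam (by simp)⟩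
    · have := isHillSolution_floquetSolution ha one_pos hlam hV
      rwa [← ofReal_pow, Real.sq_sqrt ht] at this
    · obtain ⟨x, hx⟩ := exists_oneSidedFourier_ne_zero (summable_norm_floquetCoeff ha one_pos hlam)
        (by simp [floquetCoeff_zero])
      exact mul_ne_zero (exp_ne_zero _) hx (congrFun h x)
end
end

section
/- Let (a_k)_{k≥1} satisfy Σ_{k=1}^∞ |a_k| < ∞, let V(x) = Σ_{k=1}^∞ a_k e^{ikx}, and let n ≥ 3 be an integer. If ρ ∈ ℂ \ {0} is a Floquet multiplier of the equation −ψ'' + Vψ = (1/n²)ψ (i.e., some nontrivial solution ψ satisfies ψ(x+2π) = ρψ(x) for all x ∈ ℝ), then ρⁿ = 1; consequently Δ(V; 1/n²) ∈ {2cos(2kπ/n) : k ∈ ℤ}. -/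
noncomputable section

open Real MeasureTheory intervalIntegral

/-- A bounded two-sided sequence `b` satisfying a one-sided convolution recurrence
`q m * b m = -∑ a_k b (m - (k + 1))` vanishes as soon as `q` has no zero and is large
near `-∞`. -/
lemma eq_zero_of_convolution_recurrence {a : ℕ → ℂ} (ha : Summable fun k => ‖a k‖)
    {b q : ℤ → ℂ} {C : ℝ} (hb : ∀ m, ‖b m‖ ≤ C) (hq0 : ∀ m, q m ≠ 0)
    (hq : ∀ R : ℝ, ∃ M : ℤ, ∀ m ≤ M, R ≤ ‖q m‖)
    (hrec : ∀ m, q m * b m = -∑' k : ℕ, a k * b (m - (k + 1))) (m : ℤ) : b m = 0 := by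
  set A := ∑' k, ‖a k‖ with hA
  have hA0 : 0 ≤ A := tsum_nonneg fun _ => norm_nonneg _
  have hC0 : 0 ≤ C := (norm_nonneg _).trans (hb 0)
  obtain ⟨M, hM⟩ := hq (2 * A + 1)
  have hdecay : ∀ j : ℕ, ∀ m ≤ M, ‖b m‖ ≤ C * (1 / 2) ^ j := by
    intro j
    induction j with
    | zero => intro m _; simpa using hb m
    | succ j ih =>
      intro m hm
      have hsum : ‖∑' k : ℕ, a k * b (m - (k + 1))‖ ≤ A * (C * (1 / 2) ^ j) := by
        refine tsum_of_norm_bounded (ha.hasSum.mul_right _) fun k => ?_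
        rw [norm_mul]
        gcongr
        exact ih _ (by lia)
      have h := congrArg norm (hrec m)
      rw [norm_mul, norm_neg] at h
      have h1 : (2 * A + 1) * ‖b m‖ ≤ A * (C * (1 / 2) ^ j) :=
        (mul_le_mul_of_nonneg_right (hM m hm) (norm_nonneg _)).trans (h.le.trans hsum)
      have hD : 0 ≤ C * (1 / 2) ^ j := by positivity
      rw [pow_succ]
      by_contra! hlt
      nlinarith [mul_le_mul_of_nonneg_left hlt.le hA0]
  have hlow : ∀ m ≤ M, b m = 0 := by
    intro m hm
    have hlim : Filter.Tendsto (fun j : ℕ => C * (1 / 2 : ℝ) ^ j) Filter.atTop (nhds 0) := by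
      simpa using (tendsto_pow_atTop_nhds_zero_of_lt_one (r := (1 / 2 : ℝ))
        (by norm_num) (by norm_num)).const_mul C
    exact norm_le_zero_iff.mp (ge_of_tendsto' hlim fun j => hdecay j m hm)
  have hup : ∀ j : ℕ, ∀ m ≤ M + j, b m = 0 := by
    intro j
    induction j with
    | zero => intro m hm; exact hlow m (by simpa using hm)
    | succ j ih =>
      intro m hm
      have h := hrec m
      have h0 : ∀ k : ℕ, a k * b (m - (k + 1)) = 0 := fun k => by
        rw [ih _ (by push_cast at hm; lia), mul_zero]
      simp only [h0, tsum_zero, neg_zero] at h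
      exact (mul_eq_zero.mp h).resolve_left (hq0 m)
  exact hup (m - M).toNat m (by lia)

/-- The Wronskian of two solutions of the same Hill equation is constant. -/
lemma IsHillSolution.wronskian_eq {V : ℝ → ℂ} {z : ℂ} {f g : ℝ → ℂ}
    (hf : IsHillSolution V z f) (hg : IsHillSolution V z g) (x y : ℝ) :
    f x * deriv g x - deriv f x * g x = f y * deriv g y - deriv f y * g y := by
  refine is_const_of_deriv_eq_zero (f := fun x => f x * deriv g x - deriv f x * g x)
    ((hf.1.mul hg.2.1).sub (hf.2.1.mul hg.1)) (fun t => ?_) x y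
  have h := (((hf.1 t).hasDerivAt.mul (hg.2.1 t).hasDerivAt).sub
    ((hf.2.1 t).hasDerivAt.mul (hg.1 t).hasDerivAt)).deriv
  refine h.trans ?_
  linear_combination g t * hf.2.2 t - f t * hg.2.2 t

/-- The Floquet discriminant is `ρ + ρ⁻¹` for every Floquet multiplier `ρ`. -/
lemma IsHillSolution.discriminant_eq {V : ℝ → ℂ} {z ρ : ℂ} {ψ c s : ℝ → ℂ} {T : ℝ} (hρ : ρ ≠ 0)
    (hψ : IsHillSolution V z ψ) (hψ0 : ψ ≠ 0) (hper : ∀ x, ψ (x + T) = ρ * ψ x)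
    (hc : IsHillSolution V z c) (hc0 : c 0 = 1) (hc0' : deriv c 0 = 0)
    (hs : IsHillSolution V z s) (hs0 : s 0 = 0) (hs0' : deriv s 0 = 1) :
    c T + deriv s T = ρ + ρ⁻¹ := by
  have hcs x := hc.wronskian_eq hs x 0
  have hψc x := hψ.wronskian_eq hc x 0
  have hψs x := hψ.wronskian_eq hs x 0
  simp only [hc0, hc0', hs0, hs0', mul_one, mul_zero, sub_zero, zero_sub] at hcs hψc hψs
  have hval x : ψ x = ψ 0 * c x + deriv ψ 0 * s x := by
    linear_combination (-ψ x) * hcs x + c x * hψs x - s x * hψc x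
  have hder x : deriv ψ x = ψ 0 * deriv c x + deriv ψ 0 * deriv s x := by
    linear_combination (-deriv ψ x) * hcs x + deriv c x * hψs x - deriv s x * hψc x
  have hper' : deriv ψ T = ρ * deriv ψ 0 := by
    have h : (fun x => ψ (x + T)) = fun x => ρ * ψ x := funext hper
    have h' := congrArg (fun f => deriv f 0) h
    simpa [deriv_comp_add_const, deriv_const_mul_field] using h'
  have h1 := hval T
  have h2 := hder T
  rw [hper'] at h2
  rw [show ψ T = ρ * ψ 0 by simpa using hper 0] at h1
  have hW := hcs T
  have hdet : ρ ^ 2 - (c T + deriv s T) * ρ + 1 = 0 := by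
    by_contra hne
    have hz0 : ψ 0 = 0 := by
      refine (mul_eq_zero.mp (?_ : (ρ ^ 2 - (c T + deriv s T) * ρ + 1) * ψ 0 = 0)).resolve_left hne
      linear_combination (ρ - deriv s T) * h1 + s T * h2 - ψ 0 * hW
    have hz1 : deriv ψ 0 = 0 := by
      refine (mul_eq_zero.mp
        (?_ : (ρ ^ 2 - (c T + deriv s T) * ρ + 1) * deriv ψ 0 = 0)).resolve_left hne
      linear_combination (ρ - c T) * h2 + deriv c T * h1 - deriv ψ 0 * hW
    exact hψ0 (funext fun x => by rw [hval x, hz0, hz1]; simp)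
  field_simp
  linear_combination -hdet

/-- A continuous `2π`-periodic function all of whose Fourier coefficients vanish is zero. -/
lemma eq_zero_of_integral_exp_eq_zero {p : ℝ → ℂ} (hp : Continuous p)
    (hper : Function.Periodic p (2 * π))
    (h : ∀ m : ℤ, ∫ x in (0 : ℝ)..2 * π, p x * Complex.exp (-(Complex.I * m * x)) = 0) (x : ℝ) :
    p x = 0 := by
  have : Fact (0 < 2 * π) := ⟨two_pi_pos⟩
  let F : C(AddCircle (2 * π), ℂ) := ⟨hper.lift, continuous_coinduced_dom.mpr hp⟩
  have hF (y : ℝ) : F y = p y := hper.lift_coe y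
  have hcoeff : fourierCoeff F = 0 := by
    funext m
    rw [fourierCoeff_eq_intervalIntegral _ m 0, Pi.zero_apply, zero_add]
    have : ∫ y in (0 : ℝ)..2 * π, fourier (-m) (y : AddCircle (2 * π)) • F y = 0 := by
      rw [← h m]
      refine integral_congr fun y _ => ?_
      simp only [hF, fourier_coe_apply, smul_eq_mul, mul_comm]
      congr 2
      push_cast
      have : (π : ℂ) ≠ 0 := by exact_mod_cast pi_ne_zero
      field_simp
    rw [this, smul_zero]
  have hsum := has_pointwise_sum_fourier_series_of_summable (f := F)
    (by rw [hcoeff]; exact summable_zero) (x : AddCircle (2 * π))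
  simp only [hcoeff, Pi.zero_apply, zero_smul, hF] at hsum
  exact hsum.unique hasSum_zero

/-- The twisted Fourier coefficient `∫₀^{2π} ψ(x) e^{-iwx} dx`. -/
def twistedCoeff (ψ : ℝ → ℂ) (w : ℂ) : ℂ :=
  ∫ x in (0 : ℝ)..2 * π, ψ x * Complex.exp (-(Complex.I * w * x))

lemma norm_exp_twist_le (α : ℂ) (m : ℤ) {x : ℝ} (hx : x ∈ Set.uIoc 0 (2 * π)) :
    ‖Complex.exp (-(Complex.I * (m + α) * x))‖ ≤ Real.exp (|α.im| * (2 * π)) := by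
  rw [Set.uIoc_of_le two_pi_pos.le] at hx
  rw [Complex.norm_exp]
  simp only [Complex.neg_re, Complex.mul_re, Complex.mul_im, Complex.I_re, Complex.I_im,
    Complex.add_re, Complex.add_im, Complex.intCast_re, Complex.intCast_im, Complex.ofReal_re,
    Complex.ofReal_im]
  gcongr
  have h1 : α.im * x ≤ |α.im| * x := by
    have := hx.1.le
    gcongr
    exact le_abs_self _
  have h2 : |α.im| * x ≤ |α.im| * (2 * π) := by
    gcongr
    exact hx.2
  linarith

/-- The twisted Fourier coefficients of a continuous function are bounded along `ℤ + α`. -/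
lemma exists_norm_twistedCoeff_le {ψ : ℝ → ℂ} (hψ : Continuous ψ) (α : ℂ) :
    ∃ C, ∀ m : ℤ, ‖twistedCoeff ψ (m + α)‖ ≤ C := by
  obtain ⟨B, hB⟩ := (isCompact_uIcc (a := (0 : ℝ)) (b := 2 * π)).exists_bound_of_continuousOn
    hψ.continuousOn
  refine ⟨B * Real.exp (|α.im| * (2 * π)) * |2 * π - 0|, fun m =>
    norm_integral_le_of_norm_le_const fun x hx => ?_⟩
  have hBx := hB x (Set.uIoc_subset_uIcc hx)
  rw [norm_mul]
  exact mul_le_mul hBx (norm_exp_twist_le α m hx) (norm_nonneg _) ((norm_nonneg _).trans hBx)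

lemma norm_potential_term (a : ℕ → ℂ) (k : ℕ) (x : ℝ) :
    ‖a k * Complex.exp (Complex.I * ((k : ℂ) + 1) * (x : ℂ))‖ = ‖a k‖ := by
  rw [norm_mul, show Complex.I * ((k : ℂ) + 1) * (x : ℂ) = (((k + 1) * x : ℝ) : ℂ) * Complex.I by
    push_cast; ring, Complex.norm_exp_ofReal_mul_I, mul_one]

/-- Multiplication by the potential acts on twisted Fourier coefficients by convolution. -/
lemma integral_potential_mul {a : ℕ → ℂ} (ha : Summable fun k => ‖a k‖) {V : ℝ → ℂ}
    (hV : ∀ x : ℝ, V x = ∑' k : ℕ, a k * Complex.exp (Complex.I * ((k : ℂ) + 1) * (x : ℂ)))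
    {ψ : ℝ → ℂ} (hψ : Continuous ψ) (w : ℂ) :
    ∫ x in (0 : ℝ)..2 * π, V x * (ψ x * Complex.exp (-(Complex.I * w * x))) =
      ∑' k : ℕ, a k * twistedCoeff ψ (w - (k + 1)) := by
  set g : ℝ → ℂ := fun x => ψ x * Complex.exp (-(Complex.I * w * x)) with hg
  have hgc : Continuous g := by fun_prop
  have hterm (x : ℝ) :
      Summable fun k : ℕ => a k * Complex.exp (Complex.I * ((k : ℂ) + 1) * (x : ℂ)) :=
    .of_norm (ha.congr fun k => (norm_potential_term a k x).symm)
  have hsum := hasSum_integral_of_dominated_convergence (μ := volume) (a := 0) (b := 2 * π)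
    (F := fun k x => a k * Complex.exp (Complex.I * ((k : ℂ) + 1) * (x : ℂ)) * g x)
    (f := fun x => V x * g x) (fun k x => ‖a k‖ * ‖g x‖)
    (fun k => (by fun_prop : Continuous _).aestronglyMeasurable)
    (fun k => .of_forall fun x _ => by rw [norm_mul, norm_potential_term])
    (.of_forall fun x _ => ha.mul_right _)
    (by simp only [tsum_mul_right]
        exact (by fun_prop : Continuous _).intervalIntegrable _ _)
    (.of_forall fun x _ => by
      rw [hV x]
      exact (hterm x).hasSum.mul_right _)
  rw [← hsum.tsum_eq]
  refine tsum_congr fun k => ?_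
  rw [twistedCoeff, ← intervalIntegral.integral_const_mul]
  refine integral_congr fun x _ => ?_
  simp only [hg]
  rw [show -(Complex.I * (w - (k + 1)) * x) =
    Complex.I * ((k : ℂ) + 1) * (x : ℂ) + -(Complex.I * w * x) by ring, Complex.exp_add]
  ring

/-- Testing the Hill equation against `e^{-iwx}`, where `e^{2πiw}` is the multiplier. -/
lemma IsHillSolution.integral_eq_zero {V : ℝ → ℂ} (hVc : Continuous V) {z ρ w : ℂ} {ψ : ℝ → ℂ}
    (hψ : IsHillSolution V z ψ) (hper : ∀ x, ψ (x + 2 * π) = ρ * ψ x)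
    (hw : Complex.exp (Complex.I * w * (2 * π)) = ρ) :
    ∫ x in (0 : ℝ)..2 * π,
      (V x - z + w ^ 2) * (ψ x * Complex.exp (-(Complex.I * w * x))) = 0 := by
  have hE (x : ℝ) : HasDerivAt (fun x : ℝ => Complex.exp (-(Complex.I * w * x)))
      (Complex.exp (-(Complex.I * w * x)) * (-(Complex.I * w))) x := by
    have h : HasDerivAt (fun x : ℝ => -(Complex.I * w * (x : ℂ))) (-(Complex.I * w)) x := by
      simpa using ((Complex.ofRealCLM.hasDerivAt (x := x)).const_mul (Complex.I * w)).fun_neg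
    exact h.cexp
  have hψc := hψ.1.continuous
  have hder0 : deriv ψ (2 * π) = ρ * deriv ψ 0 := by
    have h' := congrArg (fun f => deriv f 0) (funext hper : (fun x => ψ (x + 2 * π)) = _)
    simpa [deriv_comp_add_const, deriv_const_mul_field] using h'
  have hval0 : ψ (2 * π) = ρ * ψ 0 := by simpa using hper 0
  rw [integral_eq_sub_of_hasDerivAt (f := fun x => (deriv ψ x + Complex.I * w * ψ x) *
    Complex.exp (-(Complex.I * w * x)))]
  · have hρ : ρ * Complex.exp (-(Complex.I * w * (2 * π))) = 1 := by
      rw [← hw, ← Complex.exp_add, add_neg_cancel, Complex.exp_zero]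
    simp only [hder0, hval0]
    push_cast
    simp only [mul_zero, neg_zero, Complex.exp_zero]
    linear_combination (deriv ψ 0 + Complex.I * w * ψ 0) * hρ
  · intro x _
    have h := (((hψ.2.1 x).hasDerivAt.add
      ((hψ.1 x).hasDerivAt.const_mul (Complex.I * w))).mul (hE x))
    refine h.congr_deriv ?_
    simp only [Pi.add_apply]
    linear_combination Complex.exp (-(Complex.I * w * x)) * (-hψ.2.2 x
      - w ^ 2 * ψ x * Complex.I_sq)
  · exact (by fun_prop : Continuous _).intervalIntegrable _ _

lemma exists_forall_le_norm_sq_sub (α z : ℂ) (R : ℝ) :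
    ∃ M : ℤ, ∀ m : ℤ, m ≤ M → R ≤ ‖((m : ℂ) + α) ^ 2 - z‖ := by
  set S := |R| + ‖z‖ + 1 with hS
  refine ⟨-⌈‖α‖ + S⌉, fun m hm => ?_⟩
  have hm' : (m : ℝ) ≤ -(‖α‖ + S) := by
    have h1 : (m : ℝ) ≤ -(⌈‖α‖ + S⌉ : ℝ) := by exact_mod_cast hm
    linarith [Int.le_ceil (‖α‖ + S)]
  have h1 : ‖(m : ℂ)‖ - ‖α‖ ≤ ‖(m : ℂ) + α‖ := by
    simpa using norm_sub_norm_le (m : ℂ) (-α)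
  rw [Complex.norm_intCast] at h1
  have h2 : S ≤ ‖(m : ℂ) + α‖ := by linarith [neg_le_abs (m : ℝ)]
  have h3 := norm_sub_norm_le (((m : ℂ) + α) ^ 2) z
  rw [norm_pow] at h3
  nlinarith [abs_nonneg R, norm_nonneg z, le_abs_self R]

/-- For a potential with only positive Fourier modes, every Floquet multiplier at energy `z`
has the form `e^{2πiw}` with `w ^ 2 = z`. -/
lemma IsHillSolution.exists_sq_eq_of_multiplier {a : ℕ → ℂ} (ha : Summable fun k => ‖a k‖)
    {V : ℝ → ℂ}
    (hV : ∀ x : ℝ, V x = ∑' k : ℕ, a k * Complex.exp (Complex.I * ((k : ℂ) + 1) * (x : ℂ)))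
    {z ρ : ℂ} {ψ : ℝ → ℂ} (hρ : ρ ≠ 0) (hψ : IsHillSolution V z ψ) (hψ0 : ψ ≠ 0)
    (hper : ∀ x, ψ (x + 2 * π) = ρ * ψ x) :
    ∃ w : ℂ, w ^ 2 = z ∧ Complex.exp (Complex.I * w * (2 * π)) = ρ := by
  have hπ : (π : ℂ) ≠ 0 := by exact_mod_cast pi_ne_zero
  have hψc := hψ.1.continuous
  have hVc : Continuous V := by
    rw [funext hV]
    exact continuous_tsum (fun k => by fun_prop) ha fun k x => (norm_potential_term a k x).le
  obtain ⟨α, hα⟩ : ∃ α : ℂ, Complex.exp (Complex.I * α * (2 * π)) = ρ := by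
    refine ⟨Complex.log ρ / (2 * π * Complex.I), ?_⟩
    rw [← Complex.exp_log hρ]
    congr 1
    rw [Complex.exp_log hρ]
    field_simp
  have hαm (m : ℤ) : Complex.exp (Complex.I * (m + α) * (2 * π)) = ρ := by
    rw [show Complex.I * (m + α) * (2 * π) = Complex.I * α * (2 * π) + m * (2 * π * Complex.I) by
      ring, Complex.exp_add, Complex.exp_int_mul_two_pi_mul_I, hα, mul_one]
  by_contra! hne
  have hrec (m : ℤ) : (((m : ℂ) + α) ^ 2 - z) * twistedCoeff ψ (m + α) =
      -∑' k : ℕ, a k * twistedCoeff ψ (((m - (k + 1) : ℤ) : ℂ) + α) := by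
    have h := hψ.integral_eq_zero hVc hper (hαm m)
    have hsplit (x : ℝ) : (V x - z + ((m : ℂ) + α) ^ 2) *
        (ψ x * Complex.exp (-(Complex.I * (m + α) * x))) =
        V x * (ψ x * Complex.exp (-(Complex.I * (m + α) * x))) +
        (((m : ℂ) + α) ^ 2 - z) * (ψ x * Complex.exp (-(Complex.I * (m + α) * x))) := by ring
    simp only [hsplit] at h
    rw [integral_add ((by fun_prop : Continuous _).intervalIntegrable _ _)
      ((by fun_prop : Continuous _).intervalIntegrable _ _), intervalIntegral.integral_const_mul,
      integral_potential_mul ha hV hψc] at h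
    have hidx (k : ℕ) : ((m - (k + 1) : ℤ) : ℂ) + α = (m : ℂ) + α - (k + 1) := by
      push_cast; ring
    simp only [hidx]
    exact eq_neg_of_add_eq_zero_right h
  obtain ⟨C, hC⟩ := exists_norm_twistedCoeff_le hψc α
  have hzero := eq_zero_of_convolution_recurrence ha hC
    (fun m h => hne (m + α) (sub_eq_zero.mp h) (hαm m))
    (exists_forall_le_norm_sq_sub α z) hrec
  refine hψ0 (funext fun x => ?_)
  have hp := eq_zero_of_integral_exp_eq_zero
    (p := fun x => ψ x * Complex.exp (-(Complex.I * α * x))) (by fun_prop) (fun y => ?_)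
    (fun m => ?_) x
  · exact (mul_eq_zero.mp hp).resolve_right (Complex.exp_ne_zero _)
  · simp only [hper]
    rw [show -(Complex.I * α * ((y + 2 * π : ℝ) : ℂ)) =
      -(Complex.I * α * y) + -(Complex.I * α * (2 * π)) by push_cast; ring, Complex.exp_add,
      Complex.exp_neg (Complex.I * α * (2 * π)), hα]
    field_simp
  · rw [← hzero m, twistedCoeff]
    refine integral_congr fun y _ => ?_
    simp only [mul_assoc, ← Complex.exp_add]
    congr 2
    ring

/-- For `V(x) = ∑_{k=1}^∞ a_k e^{ikx}` with `∑|a_k| < ∞` and `n ≥ 3`: any Floquet multiplier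
`ρ` of `-ψ'' + Vψ = (1/n²)ψ` satisfies `ρⁿ = 1`, and hence the Floquet discriminant
`Δ(V;1/n²) = c(2π) + s'(2π)` lies in `{2 cos(2kπ/n) : k ∈ ℤ}`. -/
theorem multiplier_is_root_of_unity
    (a : ℕ → ℂ) (ha : Summable fun k => ‖a k‖)
    (V : ℝ → ℂ)
    (hV : ∀ x : ℝ, V x = ∑' k : ℕ, a k * Complex.exp (Complex.I * ((k : ℂ) + 1) * (x : ℂ)))
    (n : ℕ) (hn : 3 ≤ n)
    (ψ : ℝ → ℂ) (ρ : ℂ) (hρ : ρ ≠ 0)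
    (hψ : IsHillSolution V (1 / (n : ℂ) ^ 2) ψ) (hψ0 : ψ ≠ 0)
    (hψper : ∀ x : ℝ, ψ (x + 2 * Real.pi) = ρ * ψ x)
    (c s : ℝ → ℂ)
    (hc : IsHillSolution V (1 / (n : ℂ) ^ 2) c) (hc0 : c 0 = 1) (hc0' : deriv c 0 = 0)
    (hs : IsHillSolution V (1 / (n : ℂ) ^ 2) s) (hs0 : s 0 = 0) (hs0' : deriv s 0 = 1) :
    ρ ^ n = 1 ∧
      ∃ k : ℤ, c (2 * Real.pi) + deriv s (2 * Real.pi) =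
        ((2 * Real.cos (2 * (k : ℝ) * Real.pi / (n : ℝ)) : ℝ) : ℂ) := by
  have hn0 : (n : ℂ) ≠ 0 := by exact_mod_cast (by lia : n ≠ 0)
  obtain ⟨w, hw, hwρ⟩ := hψ.exists_sq_eq_of_multiplier ha hV hρ hψ0 hψper
  have hsq : (w * n - 1) * (w * n + 1) = 0 := by
    field_simp at hw
    linear_combination hw
  obtain ⟨k, hk⟩ : ∃ k : ℤ, w = k / n := by
    rcases mul_eq_zero.mp hsq with h | h
    · exact ⟨1, by rw [eq_div_iff hn0]; push_cast; linear_combination h⟩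
    · exact ⟨-1, by rw [eq_div_iff hn0]; push_cast; linear_combination h⟩
  refine ⟨?_, k, ?_⟩
  · rw [← hwρ, ← Complex.exp_nat_mul, hk,
      show (n : ℂ) * (Complex.I * (k / n) * (2 * π)) = k * (2 * π * Complex.I) by field_simp,
      Complex.exp_int_mul_two_pi_mul_I]
  · rw [hψ.discriminant_eq hρ hψ0 hψper hc hc0 hc0' hs hs0 hs0', ← hwρ, hk, ← Complex.exp_neg]
    push_cast
    rw [Complex.two_cos]
    congr 2 <;> ring
end
end
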